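/- Let 0 < α < n, 0 < β < 1 with α + β < n, and 1 < η < n/(α+β), and let Ω be homogeneous of degree zero, have mean value zero on S^{n−1}, and be a Lipschitz function. There exists a constant C, independent of b, f, Q and x, such that for every b ∈ Lip_β(ℝ^n), every locally η-integrable function f, every cube Q ⊂ ℝ^n, and every x ∈ Q: |Q|^{-1} ∫_Q | T_{Ω,α}( (b − b_{2Q}) f χ_{2Q} )(z) | dz ≤ C ‖b‖_{Lip_β} ( M_{αη+βη}(|f|^η)(x) )^{1/η}, where 2Q is the cube concentric with Q of twice the side length and χ_{2Q} its characteristic function. -/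

import Mathlib

open MeasureTheory ENNReal Metric

noncomputable section

/-- The (closed) cube centered at `x` with side length `r`. -/
def cube {n : ℕ} (x : EuclideanSpace ℝ (Fin n)) (r : ℝ) : Set (EuclideanSpace ℝ (Fin n)) :=
  {y | ∀ i, |y i - x i| ≤ r / 2}

/-- The average `f_Q = |Q|⁻¹ ∫_Q f` of `f` over a set `Q`. -/
def setAvg {n : ℕ} (Q : Set (EuclideanSpace ℝ (Fin n))) (f : EuclideanSpace ℝ (Fin n) → ℝ) : ℝ :=
  (volume Q).toReal⁻¹ * ∫ y in Q, f y

/-- Slice norm of an `ℝ≥0∞`-valued function. -/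
def sliceNormE {n : ℕ} (p q t : ℝ) (g : EuclideanSpace ℝ (Fin n) → ℝ≥0∞) : ℝ≥0∞ :=
  (∫⁻ x, ((volume (cube x t))⁻¹ * ∫⁻ y in cube x t, g y ^ p) ^ (q / p)) ^ (1 / q)

/-- The slice space norm `‖f‖_{(E_p^q)_t}`. -/
def sliceNorm {n : ℕ} (p q t : ℝ) (f : EuclideanSpace ℝ (Fin n) → ℝ) : ℝ≥0∞ :=
  sliceNormE p q t fun y => ENNReal.ofReal |f y|

/-- Membership in the slice space `(E_p^q)_t(ℝⁿ)`. -/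
def MemSlice {n : ℕ} (p q t : ℝ) (f : EuclideanSpace ℝ (Fin n) → ℝ) : Prop :=
  Measurable f ∧ sliceNorm p q t f ≠ ∞

/-- The BMO seminorm, as a supremum over all cubes. -/
def bmoNorm {n : ℕ} (b : EuclideanSpace ℝ (Fin n) → ℝ) : ℝ≥0∞ :=
  ⨆ (x : EuclideanSpace ℝ (Fin n)) (r : ℝ) (_ : 0 < r),
    (volume (cube x r))⁻¹ * ∫⁻ y in cube x r, ENNReal.ofReal |b y - setAvg (cube x r) b|

/-- Membership in `BMO(ℝⁿ)`. -/
def MemBMO {n : ℕ} (b : EuclideanSpace ℝ (Fin n) → ℝ) : Prop :=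
  LocallyIntegrable b volume ∧ bmoNorm b ≠ ∞

/-- `Ω` is homogeneous of degree zero. -/
def HomogZero {n : ℕ} (Ω : EuclideanSpace ℝ (Fin n) → ℝ) : Prop :=
  ∀ lam : ℝ, 0 < lam → ∀ x : EuclideanSpace ℝ (Fin n), x ≠ 0 → Ω (lam • x) = Ω x

/-- `Ω` has mean value zero on the unit sphere. -/
def MeanZeroOnSphere {n : ℕ} (Ω : EuclideanSpace ℝ (Fin n) → ℝ) : Prop :=
  ∫ x : sphere (0 : EuclideanSpace ℝ (Fin n)) 1, Ω x
    ∂((volume : Measure (EuclideanSpace ℝ (Fin n))).toSphere) = 0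

/-- The fractional integral operator with rough kernel,
`T_{Ω,α} f (x) = ∫ Ω(x-y) |x-y|^{α-n} f(y) dy`. -/
def fracInt {n : ℕ} (Ω : EuclideanSpace ℝ (Fin n) → ℝ) (α : ℝ)
    (f : EuclideanSpace ℝ (Fin n) → ℝ) (x : EuclideanSpace ℝ (Fin n)) : ℝ :=
  ∫ y, Ω (x - y) * ‖x - y‖ ^ (α - n) * f y

/-- The commutator `[b, T_{Ω,α}] f = b ⬝ T_{Ω,α} f - T_{Ω,α}(b f)`. -/
def commutatorOp {n : ℕ} (Ω : EuclideanSpace ℝ (Fin n) → ℝ) (α : ℝ)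
    (b f : EuclideanSpace ℝ (Fin n) → ℝ) : EuclideanSpace ℝ (Fin n) → ℝ :=
  fun x => b x * fracInt Ω α f x - fracInt Ω α (fun y => b y * f y) x

/-- The fractional maximal operator `M_γ` (over cubes); `γ = 0` gives the
Hardy–Littlewood maximal operator. -/
def fracMax {n : ℕ} (γ : ℝ) (f : EuclideanSpace ℝ (Fin n) → ℝ)
    (x : EuclideanSpace ℝ (Fin n)) : ℝ≥0∞ :=
  ⨆ (z : EuclideanSpace ℝ (Fin n)) (r : ℝ) (_ : 0 < r) (_ : x ∈ cube z r),
    volume (cube z r) ^ (γ / n - 1) * ∫⁻ y in cube z r, ENNReal.ofReal |f y|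

/-- The Fefferman–Stein sharp maximal operator `M^♯`. -/
def sharpMax {n : ℕ} (f : EuclideanSpace ℝ (Fin n) → ℝ)
    (x : EuclideanSpace ℝ (Fin n)) : ℝ≥0∞ :=
  ⨆ (z : EuclideanSpace ℝ (Fin n)) (r : ℝ) (_ : 0 < r) (_ : x ∈ cube z r),
    (volume (cube z r))⁻¹ * ∫⁻ y in cube z r, ENNReal.ofReal |f y - setAvg (cube z r) f|

/-- The `L^p` norm. -/
def lpNorm {n : ℕ} (p : ℝ) (f : EuclideanSpace ℝ (Fin n) → ℝ) : ℝ≥0∞ :=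
  (∫⁻ x, ENNReal.ofReal |f x| ^ p) ^ (1 / p)

/-- The set of admissible Hölder–Lipschitz constants of order `β` for `b`. -/
def LipConstSet {n : ℕ} (β : ℝ) (b : EuclideanSpace ℝ (Fin n) → ℝ) : Set ℝ :=
  {C : ℝ | ∀ x y, |b x - b y| ≤ C * dist x y ^ β}

/-- Membership in the Lipschitz space `Lip_β(ℝⁿ)`. -/
def MemLip {n : ℕ} (β : ℝ) (b : EuclideanSpace ℝ (Fin n) → ℝ) : Prop :=
  (LipConstSet β b).Nonempty

/-- The `Lip_β` norm: the least admissible constant. -/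
def lipNorm {n : ℕ} (β : ℝ) (b : EuclideanSpace ℝ (Fin n) → ℝ) : ℝ :=
  sInf (LipConstSet β b)

theorem cube_eq_preimage {n : ℕ} (x : EuclideanSpace ℝ (Fin n)) (r : ℝ) :
    cube x r = WithLp.ofLp ⁻¹'
      Set.Icc (fun i => x i - r / 2 : Fin n → ℝ) (fun i => x i + r / 2) := by
  ext y
  simp only [cube, Set.mem_ofPred_eq, Set.mem_preimage, Set.mem_Icc, Pi.le_def, abs_le,
    ← forall_and]
  refine forall_congr' fun i => ?_
  constructor <;> rintro ⟨h1, h2⟩ <;> constructor <;> linarith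

theorem measurableSet_cube {n : ℕ} (x : EuclideanSpace ℝ (Fin n)) (r : ℝ) :
    MeasurableSet (cube x r) := by
  rw [cube_eq_preimage]
  exact (PiLp.volume_preserving_ofLp (Fin n)).measurable measurableSet_Icc

theorem volume_cube {n : ℕ} (x : EuclideanSpace ℝ (Fin n)) {r : ℝ} (hr : 0 ≤ r) :
    volume (cube x r) = ENNReal.ofReal (r ^ n) := by
  rw [cube_eq_preimage, (PiLp.volume_preserving_ofLp (Fin n)).measure_preimage
    measurableSet_Icc.nullMeasurableSet, Real.volume_Icc_pi]
  simp only [add_sub_sub_cancel, add_halves, Finset.prod_const, Finset.card_univ,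
    Fintype.card_fin]
  rw [ENNReal.ofReal_pow hr]

theorem dist_le_sqrt_mul {n : ℕ} {x y : EuclideanSpace ℝ (Fin n)} {d : ℝ} (hd : 0 ≤ d)
    (h : ∀ i, |x i - y i| ≤ d) : dist x y ≤ √n * d := by
  rw [EuclideanSpace.dist_eq]
  refine Real.sqrt_le_iff.2 ⟨by positivity, ?_⟩
  calc ∑ i, dist (x i) (y i) ^ 2 ≤ ∑ _i : Fin n, d ^ 2 :=
        Finset.sum_le_sum fun i _ => by
          rw [Real.dist_eq]
          exact pow_le_pow_left₀ (abs_nonneg _) (h i) 2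
    _ = (√n * d) ^ 2 := by
        rw [mul_pow, Real.sq_sqrt (Nat.cast_nonneg n)]
        simp

theorem dist_le_of_mem_cube_two_mul {n : ℕ} {x₀ x y : EuclideanSpace ℝ (Fin n)} {r : ℝ}
    (hr : 0 ≤ r) (hx : x ∈ cube x₀ (2 * r)) (hy : y ∈ cube x₀ (2 * r)) :
    dist x y ≤ √n * (2 * r) := by
  refine dist_le_sqrt_mul (by positivity) fun i => ?_
  have h1 := abs_le.1 (hx i)
  have h2 := abs_le.1 (hy i)
  exact abs_le.2 ⟨by linarith, by linarith⟩

theorem cube_subset_cube {n : ℕ} (x : EuclideanSpace ℝ (Fin n)) {r s : ℝ} (h : r ≤ s) :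
    cube x r ⊆ cube x s := fun _ hy i => (hy i).trans (by linarith)

/-- The Riesz kernel of order `α` has mass at most a multiple of `R ^ α` on balls of radius `R`
around its singularity. -/
theorem exists_setLIntegral_ball_rpow_le {n : ℕ} (hn : 1 ≤ n) {α : ℝ} (hα : 0 < α) :
    ∃ K > (0 : ℝ), ∀ R > (0 : ℝ), ∀ y : EuclideanSpace ℝ (Fin n),
      ∫⁻ z in ball y R, ENNReal.ofReal (‖z - y‖ ^ (α - n)) ≤ ENNReal.ofReal (K * R ^ α) := by
  have : Nonempty (Fin n) := ⟨⟨0, hn⟩⟩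
  set B : ℝ := (volume : Measure (EuclideanSpace ℝ (Fin n))).real (ball 0 1)
  have hBpos : 0 < B := ENNReal.toReal_pos (measure_ball_pos _ _ one_pos).ne' measure_ball_lt_top.ne
  refine ⟨n * B / α, by positivity, fun R hR y => ?_⟩
  set g : ℝ → ℝ := (Set.Iio R).indicator fun t => t ^ (α - n) with hg
  have hprod : ∀ t ∈ Set.Ioi (0 : ℝ), t ^ (n - 1) • g t =
      (Set.Ioo 0 R).indicator (fun t => t ^ (α - 1)) t := by
    intro t ht
    have ht' : 0 < t := ht
    by_cases htR : t < R
    · rw [hg, Set.indicator_of_mem (show t ∈ Set.Iio R from htR),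
        Set.indicator_of_mem (show t ∈ Set.Ioo 0 R from ⟨ht', htR⟩), smul_eq_mul,
        ← Real.rpow_natCast, ← Real.rpow_add ht', Nat.cast_sub hn]
      congr 1
      push_cast
      ring
    · rw [hg, Set.indicator_of_notMem (show t ∉ Set.Iio R from htR),
        Set.indicator_of_notMem (fun h => htR h.2), smul_zero]
  have hint0 : IntegrableOn (fun t : ℝ => t ^ (α - 1)) (Set.Ioc 0 R) :=
    (intervalIntegrable_iff_integrableOn_Ioc_of_le hR.le).1
      (intervalIntegral.intervalIntegrable_rpow' (by linarith))
  have hint1 : IntegrableOn (fun t : ℝ => t ^ (n - 1) • g t) (Set.Ioi 0) := by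
    rw [integrableOn_congr_fun hprod measurableSet_Ioi]
    exact ((integrable_indicator_iff measurableSet_Ioo).2
      (hint0.mono_set Set.Ioo_subset_Ioc_self)).integrableOn
  have hint : Integrable (fun z : EuclideanSpace ℝ (Fin n) => g ‖z‖) := by
    rw [integrable_fun_norm_addHaar, finrank_euclideanSpace_fin]
    exact hint1
  have hval : ∫ z : EuclideanSpace ℝ (Fin n), g ‖z‖ = n * B / α * R ^ α := by
    rw [integral_fun_norm_addHaar, finrank_euclideanSpace_fin,
      setIntegral_congr_fun measurableSet_Ioi hprod, setIntegral_indicator measurableSet_Ioo,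
      Set.inter_eq_self_of_subset_right (fun t ht => ht.1), ← integral_Ioc_eq_integral_Ioo,
      ← intervalIntegral.integral_of_le hR.le, integral_rpow (Or.inl (by linarith)),
      sub_add_cancel, Real.zero_rpow hα.ne', sub_zero, nsmul_eq_mul, smul_eq_mul]
    ring
  have hnonneg : ∀ z : EuclideanSpace ℝ (Fin n), 0 ≤ g ‖z‖ := fun z =>
    Set.indicator_apply_nonneg fun _ => Real.rpow_nonneg (norm_nonneg z) _
  rw [← hval, ofReal_integral_eq_lintegral_ofReal hint (Filter.Eventually.of_forall hnonneg),
    ← lintegral_indicator measurableSet_ball,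
    ← lintegral_sub_right_eq_self (fun z => ENNReal.ofReal (g ‖z‖)) y]
  refine (lintegral_congr fun z => ?_).le
  by_cases hz : z ∈ ball y R
  · rw [Set.indicator_of_mem hz, hg,
      Set.indicator_of_mem (show ‖z - y‖ ∈ Set.Iio R from mem_ball_iff_norm.1 hz)]
  · rw [Set.indicator_of_notMem hz, hg,
      Set.indicator_of_notMem (show ‖z - y‖ ∉ Set.Iio R from fun h => hz (mem_ball_iff_norm.2 h)),
      ENNReal.ofReal_zero]

theorem HomogZero.exists_abs_le {n : ℕ} {Ω : EuclideanSpace ℝ (Fin n) → ℝ} (hhom : HomogZero Ω)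
    (hcont : ContinuousOn Ω (sphere 0 1)) : ∃ M > (0 : ℝ), ∀ x, x ≠ 0 → |Ω x| ≤ M := by
  obtain ⟨M, hM⟩ := (isCompact_sphere (0 : EuclideanSpace ℝ (Fin n)) 1).exists_bound_of_continuousOn
    hcont
  refine ⟨max M 1, by positivity, fun x hx => ?_⟩
  have hx' : 0 < ‖x‖ := norm_pos_iff.2 hx
  rw [← hhom ‖x‖⁻¹ (inv_pos.2 hx') x hx]
  refine (hM _ ?_).trans (le_max_left _ _)
  rw [mem_sphere_zero_iff_norm, norm_smul, norm_inv, norm_norm, inv_mul_cancel₀ hx'.ne']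

theorem zero_mem_lowerBounds_lipConstSet {n : ℕ} (hn : 1 ≤ n) (β : ℝ) (b : EuclideanSpace ℝ (Fin n) → ℝ) :
    0 ∈ lowerBounds (LipConstSet β b) := by
  intro C hC
  have h := (abs_nonneg _).trans (hC (EuclideanSpace.single ⟨0, hn⟩ 1) 0)
  rwa [dist_zero_right, PiLp.norm_single, norm_one, Real.one_rpow, mul_one] at h

theorem lipNorm_nonneg {n : ℕ} (hn : 1 ≤ n) (β : ℝ) (b : EuclideanSpace ℝ (Fin n) → ℝ) :
    0 ≤ lipNorm β b :=
  Real.sInf_nonneg fun _ hC => zero_mem_lowerBounds_lipConstSet hn β b hC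

theorem MemLip.abs_sub_le {n : ℕ} {β : ℝ} (hβ : 0 < β)
    {b : EuclideanSpace ℝ (Fin n) → ℝ} (hb : MemLip β b) (x y : EuclideanSpace ℝ (Fin n)) :
    |b x - b y| ≤ lipNorm β b * dist x y ^ β := by
  rcases eq_or_ne x y with rfl | hxy
  · simp [Real.zero_rpow hβ.ne']
  · have hd : 0 < dist x y ^ β := Real.rpow_pos_of_pos (dist_pos.2 hxy) β
    rw [← div_le_iff₀ hd]
    exact le_csInf hb fun C hC => (div_le_iff₀ hd).2 (hC x y)

theorem MemLip.continuous {n : ℕ} {β : ℝ} (hβ : 0 < β)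
    {b : EuclideanSpace ℝ (Fin n) → ℝ} (hb : MemLip β b) : Continuous b := by
  obtain ⟨C, hC⟩ := hb
  refine continuous_iff_continuousAt.2 fun x => tendsto_iff_dist_tendsto_zero.2 ?_
  refine squeeze_zero (g := fun y => C * dist y x ^ β) (fun _ => dist_nonneg)
    (fun y => by rw [Real.dist_eq]; exact hC y x) ?_
  have h : Continuous fun y => C * dist y x ^ β :=
    continuous_const.mul ((continuous_id.dist continuous_const).rpow_const fun _ => Or.inr hβ.le)
  simpa [Real.zero_rpow hβ.ne'] using h.tendsto x

theorem abs_sub_setAvg_le {n : ℕ} {Q : Set (EuclideanSpace ℝ (Fin n))} (hQ : MeasurableSet Q)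
    (h0 : volume Q ≠ 0) (htop : volume Q ≠ ∞) {b : EuclideanSpace ℝ (Fin n) → ℝ}
    (hb : Continuous b) {y : EuclideanSpace ℝ (Fin n)} {D : ℝ}
    (h : ∀ w ∈ Q, |b y - b w| ≤ D) : |b y - setAvg Q b| ≤ D := by
  have hmem : ∀ w ∈ Q, b w ∈ closedBall (b y) D := fun w hw => by
    rw [mem_closedBall, dist_comm, Real.dist_eq]
    exact h w hw
  have hae : ∀ᵐ w ∂volume.restrict Q, b w ∈ closedBall (b y) D :=
    (ae_restrict_iff' hQ).2 (Filter.Eventually.of_forall hmem)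
  have hint : IntegrableOn b Q := by
    refine Measure.integrableOn_of_bounded (M := |b y| + D) htop hb.aestronglyMeasurable ?_
    filter_upwards [hae] with w hw
    rw [mem_closedBall, Real.dist_eq] at hw
    rw [Real.norm_eq_abs]
    have := abs_add_le (b w - b y) (b y)
    rw [sub_add_cancel] at this
    linarith
  have := (convex_closedBall (b y) D).set_average_mem isClosed_closedBall h0 htop hae hint
  rwa [setAverage_eq, mem_closedBall, dist_comm, Real.dist_eq, smul_eq_mul] at this

theorem ofReal_abs_fracInt_indicator_le {n : ℕ} {Ω : EuclideanSpace ℝ (Fin n) → ℝ} {α M D : ℝ}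
    (hαn : α < n) (hM : 0 ≤ M) (hΩ : ∀ x, x ≠ 0 → |Ω x| ≤ M)
    {S : Set (EuclideanSpace ℝ (Fin n))} (hS : MeasurableSet S)
    {g f : EuclideanSpace ℝ (Fin n) → ℝ} (hg : ∀ y ∈ S, |g y| ≤ D)
    (z : EuclideanSpace ℝ (Fin n)) :
    ENNReal.ofReal |fracInt Ω α (S.indicator fun y => g y * f y) z| ≤
      ENNReal.ofReal M * ENNReal.ofReal D *
        ∫⁻ y in S, ENNReal.ofReal (‖z - y‖ ^ (α - n)) * ENNReal.ofReal |f y| := by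
  rw [← Real.enorm_eq_ofReal_abs, fracInt, ← lintegral_const_mul' _ _ (by finiteness),
    ← lintegral_indicator hS]
  refine (enorm_integral_le_lintegral_enorm _).trans (lintegral_mono fun y => ?_)
  dsimp only
  by_cases hy : y ∈ S
  · rw [Set.indicator_of_mem hy, Set.indicator_of_mem hy]
    have hker : |Ω (z - y) * ‖z - y‖ ^ (α - n)| ≤ M * ‖z - y‖ ^ (α - n) := by
      rw [abs_mul, abs_of_nonneg (Real.rpow_nonneg (norm_nonneg _) _)]
      rcases eq_or_ne (z - y) 0 with h0 | h0
      · rw [h0, norm_zero, Real.zero_rpow (by linarith), mul_zero, mul_zero]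
      · exact mul_le_mul_of_nonneg_right (hΩ _ h0) (Real.rpow_nonneg (norm_nonneg _) _)
    have hD : 0 ≤ D := (abs_nonneg _).trans (hg y hy)
    have hk := Real.rpow_nonneg (norm_nonneg (z - y)) (α - n)
    rw [Real.enorm_eq_ofReal_abs, ← ENNReal.ofReal_mul hM, ← ENNReal.ofReal_mul hk,
      ← ENNReal.ofReal_mul (by positivity)]
    refine ENNReal.ofReal_le_ofReal ?_
    rw [abs_mul, abs_mul (g y)]
    calc |Ω (z - y) * ‖z - y‖ ^ (α - n)| * (|g y| * |f y|)
        ≤ M * ‖z - y‖ ^ (α - n) * (D * |f y|) := by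
          gcongr
          exact hg y hy
      _ = M * D * (‖z - y‖ ^ (α - n) * |f y|) := by ring
  · simp [Set.indicator_of_notMem hy]

theorem setLIntegral_setLIntegral_kernel_le {n : ℕ} {α : ℝ} {κ : ℝ≥0∞}
    {S T : Set (EuclideanSpace ℝ (Fin n))} (hT : MeasurableSet T)
    {F : EuclideanSpace ℝ (Fin n) → ℝ≥0∞} (hF : Measurable F)
    (hκ : ∀ y ∈ T, ∫⁻ z in S, ENNReal.ofReal (‖z - y‖ ^ (α - n)) ≤ κ) :
    ∫⁻ z in S, ∫⁻ y in T, ENNReal.ofReal (‖z - y‖ ^ (α - n)) * F y ≤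
      κ * ∫⁻ y in T, F y := by
  rw [lintegral_lintegral_swap (by fun_prop), ← lintegral_const_mul _ hF]
  refine setLIntegral_mono' hT fun y hy => ?_
  rw [lintegral_mul_const _ (by fun_prop)]
  gcongr
  exact hκ y hy

theorem setLIntegral_le_rpow_mul_rpow {X : Type*} [MeasurableSpace X] {μ : Measure X} {η : ℝ}
    (hη : 1 < η) (S : Set X) {F : X → ℝ≥0∞} (hF : Measurable F) :
    ∫⁻ y in S, F y ∂μ ≤ (∫⁻ y in S, F y ^ η ∂μ) ^ (1 / η) * μ S ^ (1 - 1 / η) := by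
  have hpq := Real.HolderConjugate.conjExponent hη
  have h := ENNReal.lintegral_mul_le_Lp_mul_Lq (μ.restrict S) hpq hF.aemeasurable
    (aemeasurable_const (b := (1 : ℝ≥0∞)))
  have he : 1 / η.conjExponent = 1 - 1 / η := by
    rw [one_div, one_div, ← hpq.one_sub_inv]
  simpa [he] using h

theorem statement16 (n : ℕ) (hn : 1 ≤ n) (α β η : ℝ) (hα0 : 0 < α) (hαn : α < n)
    (hβ0 : 0 < β) (hβ1 : β < 1) (hαβ : α + β < n)
    (hη1 : 1 < η) (hη : η < n / (α + β))
    (Ω : EuclideanSpace ℝ (Fin n) → ℝ) (hhom : HomogZero Ω) (hmean : MeanZeroOnSphere Ω)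
    (L : NNReal) (hlip : LipschitzOnWith L Ω (sphere (0 : EuclideanSpace ℝ (Fin n)) 1)) :
    ∃ C > (0 : ℝ), ∀ b : EuclideanSpace ℝ (Fin n) → ℝ, MemLip β b →
      ∀ f : EuclideanSpace ℝ (Fin n) → ℝ, Measurable f → LocallyIntegrable (fun y => |f y| ^ η) volume →
      ∀ (x₀ : EuclideanSpace ℝ (Fin n)) (r : ℝ), 0 < r → ∀ x ∈ cube x₀ r,
        (volume (cube x₀ r))⁻¹ *
            ∫⁻ z in cube x₀ r, ENNReal.ofReal
              |fracInt Ω α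
                ((cube x₀ (2 * r)).indicator fun y =>
                  (b y - setAvg (cube x₀ (2 * r)) b) * f y) z| ≤
          ENNReal.ofReal (C * lipNorm β b) *
            (fracMax (α * η + β * η) (fun y => |f y| ^ η) x) ^ (1 / η) := by
  have hη0 : 0 < η := by linarith
  have hn0 : (0 : ℝ) < n := by exact_mod_cast hn
  obtain ⟨M, hM, hΩ⟩ := hhom.exists_abs_le hlip.continuousOn
  obtain ⟨K, hK, hker⟩ := exists_setLIntegral_ball_rpow_le hn hα0
  refine ⟨M * K * 2 ^ n * (3 * √n / 2) ^ (α + β), by positivity, ?_⟩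
  intro b hb f hf _ x₀ r hr x hx
  have h2r : 0 < 2 * r := by linarith
  set A := lipNorm β b with hA
  have hA0 : 0 ≤ A := lipNorm_nonneg hn β b
  set R : ℝ := 3 * √n * r with hR
  have hRpos : 0 < R := by positivity
  have hdist : ∀ y ∈ cube x₀ (2 * r), ∀ w ∈ cube x₀ (2 * r), dist y w < R := by
    intro y hy w hw
    refine (dist_le_of_mem_cube_two_mul hr.le hy hw).trans_lt ?_
    have : 0 < √(n : ℝ) * r := by positivity
    rw [hR]
    linarith
  set Q := cube x₀ r with hQ
  set T := cube x₀ (2 * r) with hT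
  have hQT : Q ⊆ T := cube_subset_cube x₀ (by linarith)
  have hTm : MeasurableSet T := measurableSet_cube _ _
  have hQvol : volume Q = ENNReal.ofReal (r ^ n) := volume_cube x₀ hr.le
  have hTvol : volume T = ENNReal.ofReal ((2 * r) ^ n) := volume_cube x₀ h2r.le
  have hT0 : volume T ≠ 0 := by
    rw [hTvol]
    exact (ENNReal.ofReal_pos.2 (by positivity)).ne'
  have hTtop : volume T ≠ ∞ := by
    rw [hTvol]
    exact ENNReal.ofReal_ne_top
  have hosc : ∀ y ∈ T, |b y - setAvg T b| ≤ A * R ^ β := by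
    intro y hy
    refine abs_sub_setAvg_le hTm hT0 hTtop (hb.continuous hβ0) fun w hw => ?_
    refine (hb.abs_sub_le hβ0 y w).trans ?_
    gcongr
    exact (hdist y hy w hw).le
  have hkerQ : ∀ y ∈ T, ∫⁻ z in Q, ENNReal.ofReal (‖z - y‖ ^ (α - n)) ≤
      ENNReal.ofReal (K * R ^ α) := fun y hy =>
    (lintegral_mono_set fun z hz => hdist z (hQT hz) y hy).trans (hker R hRpos y)
  set F : EuclideanSpace ℝ (Fin n) → ℝ≥0∞ := fun y => ENNReal.ofReal |f y| with hF
  have hFm : Measurable F := by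
    have : Measurable fun y => |f y| := continuous_abs.measurable.comp hf
    exact this.ennreal_ofReal
  have hLHS : ∫⁻ z in Q, ENNReal.ofReal |fracInt Ω α
        (T.indicator fun y => (b y - setAvg T b) * f y) z| ≤
      ENNReal.ofReal M * ENNReal.ofReal (A * R ^ β) *
        (ENNReal.ofReal (K * R ^ α) * ∫⁻ y in T, F y) := by
    refine (lintegral_mono fun z =>
      ofReal_abs_fracInt_indicator_le hαn hM.le hΩ hTm hosc z).trans ?_
    rw [lintegral_const_mul' _ _ (by finiteness)]
    gcongr
    exact setLIntegral_setLIntegral_kernel_le hTm hFm hkerQ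
  set I : ℝ≥0∞ := ∫⁻ y in T, F y ^ η with hI
  have hmax : volume T ^ ((α + β) / n - 1 / η) * I ^ (1 / η) ≤
      fracMax (α * η + β * η) (fun y => |f y| ^ η) x ^ (1 / η) := by
    have hIeq : I = ∫⁻ y in T, ENNReal.ofReal |(|f y| ^ η)| := by
      refine lintegral_congr fun y => ?_
      rw [hF, ENNReal.ofReal_rpow_of_nonneg (abs_nonneg _) hη0.le,
        abs_of_nonneg (Real.rpow_nonneg (abs_nonneg _) _)]
    have hexp : (α + β) / n - 1 / η = ((α * η + β * η) / n - 1) * (1 / η) := by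
      field_simp
    rw [hexp, ENNReal.rpow_mul, ← ENNReal.mul_rpow_of_nonneg _ _ (by positivity), hIeq]
    refine ENNReal.rpow_le_rpow ?_ (by positivity)
    exact le_iSup₂_of_le x₀ (2 * r) (le_iSup₂_of_le h2r (hQT hx) le_rfl)
  have hconst : (volume Q)⁻¹ * (ENNReal.ofReal M * ENNReal.ofReal (A * R ^ β) *
      ENNReal.ofReal (K * R ^ α)) * volume T ^ (1 - 1 / η) =
      ENNReal.ofReal (M * K * 2 ^ n * (3 * √n / 2) ^ (α + β) * A) *
        volume T ^ ((α + β) / n - 1 / η) := by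
    have hsplit : (1 - 1 / η : ℝ) = (1 - (α + β) / n) + ((α + β) / n - 1 / η) := by ring
    rw [hsplit, ENNReal.rpow_add _ _ hT0 hTtop, ← mul_assoc]
    congr 1
    rw [hTvol, hQvol, ENNReal.ofReal_rpow_of_pos (by positivity),
      ← ENNReal.ofReal_inv_of_pos (by positivity), ← ENNReal.ofReal_mul hM.le,
      ← ENNReal.ofReal_mul (by positivity), ← ENNReal.ofReal_mul (by positivity),
      ← ENNReal.ofReal_mul (by positivity)]
    congr 1
    have hTpow : ((2 * r) ^ n) ^ (1 - (α + β) / n) = (2 * r) ^ n / (2 * r) ^ (α + β) := by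
      rw [Real.rpow_sub (by positivity), Real.rpow_one, ← Real.rpow_natCast, ← Real.rpow_mul h2r.le,
        mul_div_cancel₀ _ hn0.ne']
    have hRpow : R ^ β * R ^ α = (3 * √n / 2) ^ (α + β) * (2 * r) ^ (α + β) := by
      rw [← Real.rpow_add hRpos, add_comm β, ← Real.mul_rpow (by positivity) h2r.le, hR]
      congr 1
      ring
    have hpos : 0 < (2 * r) ^ (α + β) := by positivity
    calc (r ^ n)⁻¹ * (M * (A * R ^ β) * (K * R ^ α)) * ((2 * r) ^ n) ^ (1 - (α + β) / n)
        = (r ^ n)⁻¹ * (M * A * K * (R ^ β * R ^ α)) * ((2 * r) ^ n / (2 * r) ^ (α + β)) := by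
          rw [hTpow]
          ring
      _ = M * K * 2 ^ n * (3 * √n / 2) ^ (α + β) * A := by
          rw [hRpow, mul_pow]
          field_simp
  calc (volume Q)⁻¹ * ∫⁻ z in Q, ENNReal.ofReal |fracInt Ω α
          (T.indicator fun y => (b y - setAvg T b) * f y) z|
      ≤ (volume Q)⁻¹ * (ENNReal.ofReal M * ENNReal.ofReal (A * R ^ β) *
          (ENNReal.ofReal (K * R ^ α) * (I ^ (1 / η) * volume T ^ (1 - 1 / η)))) := by
        gcongr
        refine hLHS.trans ?_
        gcongr
        exact setLIntegral_le_rpow_mul_rpow hη1 T hFm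
    _ = (volume Q)⁻¹ * (ENNReal.ofReal M * ENNReal.ofReal (A * R ^ β) *
          ENNReal.ofReal (K * R ^ α)) * volume T ^ (1 - 1 / η) * I ^ (1 / η) := by ring
    _ = ENNReal.ofReal (M * K * 2 ^ n * (3 * √n / 2) ^ (α + β) * A) *
          (volume T ^ ((α + β) / n - 1 / η) * I ^ (1 / η)) := by
        rw [hconst, mul_assoc]
    _ ≤ _ := by gcongr


end
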